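/- Let G be an acyclic (non-cyclic) simple dimension group, x₁, …, x_J strictly positive elements of G, and n ≥ 1. Then there exist I ≥ 1, strictly positive elements y₁, …, y_I of G, and integers A(i,j) ≥ n for all i, j, such that x_j = Σᵢ A(i,j) yᵢ for all 1 ≤ j ≤ J. -/

import Mathlib

/-- `P` is the positive cone of an ordered abelian group structure on `G`. -/
def IsPosCone {G : Type*} [AddCommGroup G] (P : Set G) : Prop :=
  (∀ a ∈ P, ∀ b ∈ P, a + b ∈ P) ∧
  (∀ g : G, ∃ a ∈ P, ∃ b ∈ P, g = a - b) ∧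
  (∀ a : G, a ∈ P → -a ∈ P → a = 0)

/-- The ordered group `(G, P)` is unperforated. -/
def Unperforated {G : Type*} [AddCommGroup G] (P : Set G) : Prop :=
  ∀ (n : ℕ) (g : G), 0 < n → n • g ∈ P → g ∈ P

/-- The ordered group `(G, P)` satisfies Riesz interpolation. -/
def RieszInterp {G : Type*} [AddCommGroup G] (P : Set G) : Prop :=
  ∀ a₁ a₂ b₁ b₂ : G,
    b₁ - a₁ ∈ P → b₁ - a₂ ∈ P → b₂ - a₁ ∈ P → b₂ - a₂ ∈ P →
    ∃ c : G, c - a₁ ∈ P ∧ c - a₂ ∈ P ∧ b₁ - c ∈ P ∧ b₂ - c ∈ P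

/-- `u` is an order unit for the cone `P`. -/
def IsOrderUnit {G : Type*} [AddCommGroup G] (P : Set G) (u : G) : Prop :=
  u ∈ P ∧ ∀ a : G, ∃ k : ℕ, 0 < k ∧ k • u - a ∈ P

/-- `(G, P)` is a simple dimension group: by the Effros-Handelman-Shen theorem, a
countable unperforated ordered abelian group with Riesz interpolation, in which every
nonzero positive element is an order unit. -/
def IsSimpleDimensionGroup {G : Type*} [AddCommGroup G] (P : Set G) : Prop :=
  Countable G ∧ IsPosCone P ∧ Unperforated P ∧ RieszInterp P ∧
    ∀ g ∈ P, g ≠ 0 → IsOrderUnit P g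

/-- A state on `(G, P)` with respect to the order unit `u`. -/
def IsState {G : Type*} [AddCommGroup G] (P : Set G) (u : G) (τ : G →+ ℝ) : Prop :=
  (∀ a ∈ P, 0 ≤ τ a) ∧ τ u = 1

/-- An extremal state: a state which is not a nontrivial convex combination of states. -/
def IsExtremalState {G : Type*} [AddCommGroup G] (P : Set G) (u : G) (τ : G →+ ℝ) : Prop :=
  IsState P u τ ∧ ∀ τ₁ τ₂ : G →+ ℝ, IsState P u τ₁ → IsState P u τ₂ →
    ∀ t : ℝ, 0 < t → t < 1 → (∀ g : G, τ g = t * τ₁ g + (1 - t) * τ₂ g) → τ₁ = τ₂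

/-- `G` is acyclic: it is not a cyclic group. -/
def IsAcyclic (G : Type*) [AddCommGroup G] : Prop :=
  ¬ ∃ g : G, ∀ x : G, ∃ n : ℤ, n • g = x

/-- The cone of `Q` has the Riesz decomposition property. -/
def RieszDecomp {G : Type*} [AddCommGroup G] (Q : AddSubmonoid G) : Prop :=
  ∀ x ∈ Q, ∀ a ∈ Q, ∀ b ∈ Q, a + b - x ∈ Q →
    ∃ c ∈ Q, x - c ∈ Q ∧ a - c ∈ Q ∧ b - (x - c) ∈ Q

/-- The positive cone together with zero, which `IsPosCone` does not require to be positive. -/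
def IsPosCone.toAddSubmonoid {G : Type*} [AddCommGroup G] {P : Set G} (hP : IsPosCone P) :
    AddSubmonoid G where
  carrier := insert 0 P
  zero_mem' := Set.mem_insert 0 P
  add_mem' := by
    rintro a b (rfl | ha) (rfl | hb)
    · simp
    · simpa using Or.inr hb
    · simpa using Or.inr ha
    · exact Or.inr (hP.1 a ha b hb)

theorem IsPosCone.mem_toAddSubmonoid {G : Type*} [AddCommGroup G] {P : Set G} (hP : IsPosCone P)
    {g : G} : g ∈ hP.toAddSubmonoid ↔ g = 0 ∨ g ∈ P :=
  Iff.rfl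

theorem IsPosCone.eq_zero_of_neg_mem {G : Type*} [AddCommGroup G] {P : Set G} (hP : IsPosCone P)
    (g : G) (hg : g ∈ hP.toAddSubmonoid) (hng : -g ∈ hP.toAddSubmonoid) : g = 0 := by
  rcases hg with hg | hg
  · exact hg
  rcases hng with hng | hng
  · exact neg_eq_zero.1 hng
  · exact hP.2.2 g hg hng

theorem RieszInterp.rieszDecomp {G : Type*} [AddCommGroup G] {P : Set G} (hR : RieszInterp P)
    (hP : IsPosCone P) : RieszDecomp hP.toAddSubmonoid := by
  intro x hx a ha b hb hab
  rcases id hx with hx0 | hx'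
  · exact ⟨0, zero_mem _, by simpa using hx, by simpa using ha, by simpa [hx0] using hb⟩
  rcases id ha with ha0 | ha'
  · exact ⟨0, zero_mem _, by simpa using hx, by simp [ha0], by simpa [ha0] using hab⟩
  rcases id hb with hb0 | hb'
  · exact ⟨x, hx, by simp, by simpa [hb0] using hab, by simp [hb0]⟩
  rcases id hab with hab0 | hab'
  · have hx_eq : x = a + b := (sub_eq_zero.1 hab0).symm
    exact ⟨a, ha, by simpa [hx_eq] using hb, by simp, by simp [hx_eq]⟩
  obtain ⟨c, h₁, h₂, h₃, h₄⟩ := hR 0 (x - b) x a (by simpa using hx') (by simpa using hb')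
    (by simpa using ha') (by rwa [show a - (x - b) = a + b - x by abel])
  refine ⟨c, Or.inr (by simpa using h₁), Or.inr h₃, Or.inr h₄, Or.inr ?_⟩
  rwa [show b - (x - c) = c - (x - b) by abel]

namespace RieszDecomp

variable {G : Type*} [AddCommGroup G] {Q : AddSubmonoid G}

/-- A submonoid containing the order interval from `0` to `y` contains every positive element
dominated by a multiple of `y`. -/
theorem mem_of_nsmul_sub_mem (hQ : RieszDecomp Q) (hneg : ∀ g ∈ Q, -g ∈ Q → g = 0)
    {y : G} (hy : y ∈ Q) (S : AddSubmonoid G) (hS : ∀ w ∈ Q, y - w ∈ Q → w ∈ S)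
    (k : ℕ) {x : G} (hx : x ∈ Q) (hk : k • y - x ∈ Q) : x ∈ S := by
  induction k generalizing x with
  | zero => rw [hneg x hx (by simpa using hk)]; exact zero_mem S
  | succ k ih =>
    obtain ⟨c, hc, hxc, hkc, hyc⟩ :=
      hQ x hx (k • y) (nsmul_mem hy k) y hy (by rwa [← succ_nsmul])
    simpa using S.add_mem (ih hc hkc) (hS _ hxc hyc)

theorem exists_common_lower_bound_of_nsmul_sub_mem (hQ : RieszDecomp Q)
    (hneg : ∀ g ∈ Q, -g ∈ Q → g = 0) {y : G} (hy : y ∈ Q)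
    (k : ℕ) {x : G} (hx : x ∈ Q) (hx0 : x ≠ 0) (hk : k • y - x ∈ Q) :
    ∃ c ∈ Q, c ≠ 0 ∧ x - c ∈ Q ∧ y - c ∈ Q := by
  induction k with
  | zero => exact absurd (hneg x hx (by simpa using hk)) hx0
  | succ k ih =>
    obtain ⟨c, hc, hxc, hkc, hyc⟩ :=
      hQ x hx (k • y) (nsmul_mem hy k) y hy (by rwa [← succ_nsmul])
    by_cases h : x - c = 0
    · rw [← sub_eq_zero.1 h] at hkc
      exact ih hkc
    · exact ⟨x - c, hxc, h, by simpa using hc, hyc⟩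

theorem exists_common_lower_bound (hQ : RieszDecomp Q) (hneg : ∀ g ∈ Q, -g ∈ Q → g = 0)
    (hu : ∀ u ∈ Q, u ≠ 0 → ∀ a : G, ∃ k : ℕ, k • u - a ∈ Q)
    {x y : G} (hx : x ∈ Q) (hx0 : x ≠ 0) (hy : y ∈ Q) (hy0 : y ≠ 0) :
    ∃ c ∈ Q, c ≠ 0 ∧ x - c ∈ Q ∧ y - c ∈ Q := by
  obtain ⟨k, hk⟩ := hu y hy hy0 x
  exact hQ.exists_common_lower_bound_of_nsmul_sub_mem hneg hy k hx hx0 hk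

theorem exists_common_lower_bound_list (hQ : RieszDecomp Q) (hneg : ∀ g ∈ Q, -g ∈ Q → g = 0)
    (hu : ∀ u ∈ Q, u ≠ 0 → ∀ a : G, ∃ k : ℕ, k • u - a ∈ Q)
    {u : G} (huQ : u ∈ Q) (hu0 : u ≠ 0) (L : List G) (hL : ∀ x ∈ L, x ∈ Q ∧ x ≠ 0) :
    ∃ c ∈ Q, c ≠ 0 ∧ ∀ x ∈ L, x - c ∈ Q := by
  induction L with
  | nil => exact ⟨u, huQ, hu0, by simp⟩
  | cons a L ih =>
    obtain ⟨c, hc, hc0, hcL⟩ := ih fun x hx => hL x (List.mem_cons_of_mem a hx)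
    obtain ⟨ha, ha0⟩ := hL a List.mem_cons_self
    obtain ⟨d, hd, hd0, had, hcd⟩ := hQ.exists_common_lower_bound hneg hu ha ha0 hc hc0
    refine ⟨d, hd, hd0, fun x hx => ?_⟩
    rcases List.mem_cons.1 hx with rfl | hx
    · exact had
    · simpa using Q.add_mem (hcL x hx) hcd

theorem exists_between (hQ : RieszDecomp Q) (hneg : ∀ g ∈ Q, -g ∈ Q → g = 0)
    (hu : ∀ u ∈ Q, u ≠ 0 → ∀ a : G, ∃ k : ℕ, k • u - a ∈ Q)
    (hgen : ∀ g : G, ∃ a ∈ Q, ∃ b ∈ Q, g = a - b) (hac : IsAcyclic G)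
    {x : G} (hx : x ∈ Q) (hx0 : x ≠ 0) :
    ∃ y ∈ Q, y ≠ 0 ∧ x - y ∈ Q ∧ x - y ≠ 0 := by
  by_contra! h
  have hmem : ∀ g ∈ Q, g ∈ AddSubgroup.zmultiples x := by
    intro g hg
    obtain ⟨k, hk⟩ := hu x hx hx0 g
    refine hQ.mem_of_nsmul_sub_mem hneg hx (AddSubgroup.zmultiples x).toAddSubmonoid ?_ k hg hk
    intro w hw hxw
    by_cases hw0 : w = 0
    · rw [hw0]; exact zero_mem _
    · rw [← sub_eq_zero.1 (h w hw hw0 hxw)]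
      exact AddSubgroup.mem_zmultiples x
  refine hac ⟨x, fun g => ?_⟩
  obtain ⟨a, ha, b, hb, rfl⟩ := hgen g
  exact AddSubgroup.mem_zmultiples_iff.1 (sub_mem (hmem a ha) (hmem b hb))

theorem exists_nsmul_le (hQ : RieszDecomp Q) (hneg : ∀ g ∈ Q, -g ∈ Q → g = 0)
    (hu : ∀ u ∈ Q, u ≠ 0 → ∀ a : G, ∃ k : ℕ, k • u - a ∈ Q)
    (hgen : ∀ g : G, ∃ a ∈ Q, ∃ b ∈ Q, g = a - b) (hac : IsAcyclic G)
    (n : ℕ) {x : G} (hx : x ∈ Q) (hx0 : x ≠ 0) :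
    ∃ y ∈ Q, y ≠ 0 ∧ x - n • y ∈ Q := by
  induction n generalizing x with
  | zero => exact ⟨x, hx, hx0, by simpa using hx⟩
  | succ n ih =>
    obtain ⟨z, hz, hz0, hxz, hxz0⟩ := hQ.exists_between hneg hu hgen hac hx hx0
    obtain ⟨w, hw, hw0, hzw⟩ := ih hz hz0
    obtain ⟨y, hy, hy0, hwy, hxzy⟩ := hQ.exists_common_lower_bound hneg hu hw hw0 hxz hxz0
    refine ⟨y, hy, hy0, ?_⟩
    have h := Q.add_mem (Q.add_mem hzw (nsmul_mem hwy n)) hxzy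
    rw [nsmul_sub] at h
    rwa [succ_nsmul, show x - (n • y + y) = z - n • w + (n • w - n • y) + (x - z - y) by abel]

/-- A decomposition of a positive element can be refined so that a given element below it becomes
a sum of the parts. -/
theorem exists_refinement (hQ : RieszDecomp Q) (hneg : ∀ g ∈ Q, -g ∈ Q → g = 0)
    (L : List G) (hL : ∀ z ∈ L, z ∈ Q) {w : G} (hw : w ∈ Q) (hLw : L.sum - w ∈ Q) :
    ∃ L' : List G, (∀ z ∈ L', z ∈ Q) ∧ L'.sum = L.sum ∧
      Submodule.span ℕ {z | z ∈ L} ≤ Submodule.span ℕ {z | z ∈ L'} ∧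
      w ∈ Submodule.span ℕ {z | z ∈ L'} := by
  induction L generalizing w with
  | nil =>
    refine ⟨[], hL, rfl, le_rfl, ?_⟩
    rw [hneg w hw (by simpa using hLw)]
    exact zero_mem _
  | cons a L ih =>
    have hLQ : ∀ z ∈ L, z ∈ Q := fun z hz => hL z (List.mem_cons_of_mem a hz)
    obtain ⟨c, hc, hwc, hac, hLc⟩ :=
      hQ w hw a (hL a List.mem_cons_self) L.sum (list_sum_mem hLQ) (by simpa using hLw)
    obtain ⟨L', hL', hsum, hspan, hmem⟩ := ih hLQ hwc hLc
    have hle : Submodule.span ℕ {z | z ∈ L'} ≤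
        Submodule.span ℕ {z | z ∈ c :: (a - c) :: L'} :=
      Submodule.span_mono fun z hz =>
        show z ∈ c :: (a - c) :: L' from List.mem_cons_of_mem c (List.mem_cons_of_mem (a - c) hz)
    have hc' : c ∈ Submodule.span ℕ {z | z ∈ c :: (a - c) :: L'} :=
      Submodule.subset_span (by simp)
    have hac' : a - c ∈ Submodule.span ℕ {z | z ∈ c :: (a - c) :: L'} :=
      Submodule.subset_span (by simp)
    refine ⟨c :: (a - c) :: L', ?_, by simp [hsum, ← add_assoc], Submodule.span_le.2 ?_, ?_⟩
    · simpa [hc, hac] using hL'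
    · intro z hz
      rcases List.mem_cons.1 hz with rfl | hz
      · simpa using add_mem hc' hac'
      · exact hle (hspan (Submodule.subset_span hz))
    · simpa using add_mem hc' (hle hmem)

theorem exists_refinement_of_nsmul_sub_mem (hQ : RieszDecomp Q)
    (hneg : ∀ g ∈ Q, -g ∈ Q → g = 0) (L : List G) (hL : ∀ z ∈ L, z ∈ Q)
    (k : ℕ) {x : G} (hx : x ∈ Q) (hk : k • L.sum - x ∈ Q) :
    ∃ L' : List G, (∀ z ∈ L', z ∈ Q) ∧ L'.sum = L.sum ∧
      Submodule.span ℕ {z | z ∈ L} ≤ Submodule.span ℕ {z | z ∈ L'} ∧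
      x ∈ Submodule.span ℕ {z | z ∈ L'} := by
  induction k generalizing x with
  | zero =>
    refine ⟨L, hL, rfl, le_rfl, ?_⟩
    rw [hneg x hx (by simpa using hk)]
    exact zero_mem _
  | succ k ih =>
    have hsum : L.sum ∈ Q := list_sum_mem hL
    obtain ⟨c, hc, hxc, hkc, hyc⟩ :=
      hQ x hx (k • L.sum) (nsmul_mem hsum k) L.sum hsum (by rwa [← succ_nsmul])
    obtain ⟨M, hM, hMsum, hMspan, hcM⟩ := ih hc hkc
    obtain ⟨N, hN, hNsum, hNspan, hxN⟩ := hQ.exists_refinement hneg M hM hxc (by rwa [hMsum])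
    exact ⟨N, hN, hNsum.trans hMsum, hMspan.trans hNspan, by simpa using add_mem (hNspan hcM) hxN⟩

theorem exists_decomposition_generating (hQ : RieszDecomp Q) (hneg : ∀ g ∈ Q, -g ∈ Q → g = 0)
    {y : G} (hy : y ∈ Q) (X : List G) (hX : ∀ x ∈ X, x ∈ Q ∧ ∃ k : ℕ, k • y - x ∈ Q) :
    ∃ L : List G, (∀ z ∈ L, z ∈ Q) ∧ L.sum = y ∧
      ∀ x ∈ X, x ∈ Submodule.span ℕ {z | z ∈ L} := by
  induction X with
  | nil => exact ⟨[y], by simpa using hy, by simp, by simp⟩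
  | cons a X ih =>
    obtain ⟨L, hL, rfl, hspan⟩ := ih fun x hx => hX x (List.mem_cons_of_mem a hx)
    obtain ⟨ha, k, hk⟩ := hX a List.mem_cons_self
    obtain ⟨M, hM, hMsum, hMspan, haM⟩ :=
      hQ.exists_refinement_of_nsmul_sub_mem hneg L hL k ha hk
    refine ⟨M, hM, hMsum, fun x hx => ?_⟩
    rcases List.mem_cons.1 hx with rfl | hx
    · exact haM
    · exact hMspan (hspan x hx)

end RieszDecomp

theorem List.exists_sum_eq_of_ne_zero {M : Type*} [AddCommMonoid M] (L : List M) :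
    ∃ (I : ℕ) (y : Fin I → M), (∀ i, y i ∈ L ∧ y i ≠ 0) ∧ ∑ i, y i = L.sum ∧
      Submodule.span ℕ {z | z ∈ L} ≤ Submodule.span ℕ (Set.range y) := by
  classical
  refine ⟨(L.filter (· ≠ 0)).length, (L.filter (· ≠ 0)).get, fun i => ?_, ?_, ?_⟩
  · simpa using List.mem_filter.1 (List.get_mem (L.filter (· ≠ 0)) i)
  · have h : (L.filter (· ≠ 0)).sum = L.sum := by
      induction L with
      | nil => rfl
      | cons a L ih => by_cases ha : a = 0 <;> simp_all
    rw [← h, ← List.sum_ofFn, List.ofFn_get]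
  · refine Submodule.span_le.2 fun z hz => ?_
    by_cases hz0 : z = 0
    · rw [hz0]; exact zero_mem _
    · refine Submodule.subset_span ?_
      rw [Set.range_list_get]
      simpa [hz0] using hz

/-- Proposition 3.1. -/
theorem stmt15 {G : Type*} [AddCommGroup G] (P : Set G)
    (hG : IsSimpleDimensionGroup P) (hac : IsAcyclic G)
    (J : ℕ) (hJ : 0 < J) (x : Fin J → G) (hx : ∀ j, x j ∈ P ∧ x j ≠ 0)
    (n : ℕ) (hn : 1 ≤ n) :
    ∃ I : ℕ, 0 < I ∧ ∃ (y : Fin I → G) (A : Fin I → Fin J → ℤ),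
      (∀ i, y i ∈ P ∧ y i ≠ 0) ∧
      (∀ i j, (n : ℤ) ≤ A i j) ∧
      ∀ j, x j = ∑ i, A i j • y i := by
  obtain ⟨-, hP, -, hR, hunit⟩ := hG
  have hQ := hR.rieszDecomp hP
  have hneg := hP.eq_zero_of_neg_mem
  have hu : ∀ u ∈ hP.toAddSubmonoid, u ≠ 0 →
      ∀ a : G, ∃ k : ℕ, k • u - a ∈ hP.toAddSubmonoid := by
    intro u huQ hu0 a
    obtain ⟨k, -, hk⟩ := (hunit u (huQ.resolve_left hu0) hu0).2 a
    exact ⟨k, Or.inr hk⟩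
  have hgen : ∀ g : G, ∃ a ∈ hP.toAddSubmonoid, ∃ b ∈ hP.toAddSubmonoid, g = a - b := by
    intro g
    obtain ⟨a, ha, b, hb, h⟩ := hP.2.1 g
    exact ⟨a, Or.inr ha, b, Or.inr hb, h⟩
  obtain ⟨c, hc, hc0, hcx⟩ := hQ.exists_common_lower_bound_list hneg hu
    (Or.inr (hx ⟨0, hJ⟩).1) (hx ⟨0, hJ⟩).2 (List.ofFn x) (by
      intro z hz
      obtain ⟨j, rfl⟩ := List.mem_ofFn.1 hz
      exact ⟨Or.inr (hx j).1, (hx j).2⟩)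
  obtain ⟨s, hs, hs0, hcs⟩ := hQ.exists_nsmul_le hneg hu hgen hac n hc hc0
  obtain ⟨L, hL, rfl, hspan⟩ := hQ.exists_decomposition_generating hneg hs
    (List.ofFn fun j => x j - n • s) (by
      intro z hz
      obtain ⟨j, rfl⟩ := List.mem_ofFn.1 hz
      refine ⟨?_, hu s hs hs0 _⟩
      simpa using add_mem (hcx (x j) (List.mem_ofFn.2 ⟨j, rfl⟩)) hcs)
  obtain ⟨I, y, hy, hsum, hle⟩ := L.exists_sum_eq_of_ne_zero
  have hcoef : ∀ j, ∃ b : Fin I → ℕ, ∑ i, b i • y i = x j - n • L.sum := fun j =>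
    Submodule.mem_span_range_iff_exists_fun ℕ |>.1
      (hle (hspan _ (List.mem_ofFn.2 ⟨j, rfl⟩)))
  choose b hb using hcoef
  refine ⟨I, ?_, y, fun i j => (n : ℤ) + b j i, fun i => ?_, fun i j => by simp, fun j => ?_⟩
  · rcases Nat.eq_zero_or_pos I with rfl | hI
    · exact absurd (by simpa using hsum.symm) hs0
    · exact hI
  · exact ⟨(hL _ (hy i).1).resolve_left (hy i).2, (hy i).2⟩
  · simp only [add_smul, natCast_zsmul, Finset.sum_add_distrib, hb, ← Finset.smul_sum, hsum]
    abel
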